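/- Suppose x >= 0. Then condition (C3) holds if and only if condition (CA3) holds. -/

import Mathlib

/-- A finite list of real numbers "has the same sign" if either all entries are
nonnegative or all entries are nonpositive. -/
def SameSign (l : List ℝ) : Prop := (∀ t ∈ l, 0 ≤ t) ∨ (∀ t ∈ l, t ≤ 0)

theorem cubic_coeff_eq {p0 p1 p2 p3 q0 q1 q2 q3 : ℝ}
    (h : ∀ s : ℝ, p3 * s ^ 3 + p2 * s ^ 2 + p1 * s + p0 = q3 * s ^ 3 + q2 * s ^ 2 + q1 * s + q0) :
    p0 = q0 ∧ p1 = q1 ∧ p2 = q2 ∧ p3 = q3 := by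
  have h0 := h 0
  have h1 := h 1
  have h2 := h (-1)
  have h3 := h 2
  norm_num at h0 h1 h2 h3
  refine ⟨?_, ?_, ?_, ?_⟩ <;> linarith

/-- The determinant of the Bezoutian of two cubics, in terms of the coefficients. -/
def bezoutDet (a0 a1 a2 a3 b0 b1 b2 b3 : ℝ) : ℝ :=
  !![b1 * a0 - a1 * b0, b2 * a0 - a2 * b0, b3 * a0 - a3 * b0;
    b2 * a0 - a2 * b0, b2 * a1 - a2 * b1 + (b3 * a0 - a3 * b0), b3 * a1 - a3 * b1;
    b3 * a0 - a3 * b0, b3 * a1 - a3 * b1, b3 * a2 - a3 * b2].det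

theorem det_eq_bezoutDet {a0 a1 a2 a3 b0 b1 b2 b3 : ℝ} {B : Matrix (Fin 3) (Fin 3) ℝ}
    (hBsymm : B.IsSymm)
    (hB : ∀ z w : ℝ, z ≠ w →
        (b3 * z ^ 3 + b2 * z ^ 2 + b1 * z + b0) * (a3 * w ^ 3 + a2 * w ^ 2 + a1 * w + a0)
          - (a3 * z ^ 3 + a2 * z ^ 2 + a1 * z + a0) * (b3 * w ^ 3 + b2 * w ^ 2 + b1 * w + b0)
          = (z - w) * ∑ i : Fin 3, ∑ j : Fin 3, B i j * z ^ (i : ℕ) * w ^ (j : ℕ)) :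
    B.det = bezoutDet a0 a1 a2 a3 b0 b1 b2 b3 := by
  have s1 : B 1 0 = B 0 1 := hBsymm.apply 0 1
  have s2 : B 2 0 = B 0 2 := hBsymm.apply 0 2
  have s3 : B 2 1 = B 1 2 := hBsymm.apply 1 2
  have e1 := hB 0 1 (by norm_num)
  have e2 := hB 0 (-1) (by norm_num)
  have e3 := hB 0 2 (by norm_num)
  have e4 := hB 1 (-1) (by norm_num)
  have e5 := hB 1 2 (by norm_num)
  have e6 := hB (-1) 2 (by norm_num)
  simp only [Fin.sum_univ_three, Fin.val_zero, Fin.val_one, Fin.val_two, s1, s2, s3]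
    at e1 e2 e3 e4 e5 e6
  ring_nf at e1 e2 e3 e4 e5 e6
  have t00 : B 0 0 = b1 * a0 - a1 * b0 := by linarith
  have t01 : B 0 1 = b2 * a0 - a2 * b0 := by linarith
  have t02 : B 0 2 = b3 * a0 - a3 * b0 := by linarith
  have t11 : B 1 1 = b2 * a1 - a2 * b1 + (b3 * a0 - a3 * b0) := by linarith
  have t12 : B 1 2 = b3 * a1 - a3 * b1 := by linarith
  have t22 : B 2 2 = b3 * a2 - a3 * b2 := by linarith
  simp only [bezoutDet, Matrix.det_fin_three, Matrix.of_apply, Matrix.cons_val,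
    s1, s2, s3, t00, t01, t02, t11, t12, t22]

theorem bezoutDet_smul_left (r a0 a1 a2 a3 b0 b1 b2 b3 : ℝ) :
    bezoutDet (r * a0) (r * a1) (r * a2) (r * a3) b0 b1 b2 b3
      = r ^ 3 * bezoutDet a0 a1 a2 a3 b0 b1 b2 b3 := by
  simp only [bezoutDet, Matrix.det_fin_three, Matrix.of_apply, Matrix.cons_val]
  ring

theorem bezoutDet_smul_right (r a0 a1 a2 a3 b0 b1 b2 b3 : ℝ) :
    bezoutDet a0 a1 a2 a3 (r * b0) (r * b1) (r * b2) (r * b3)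
      = r ^ 3 * bezoutDet a0 a1 a2 a3 b0 b1 b2 b3 := by
  simp only [bezoutDet, Matrix.det_fin_three, Matrix.of_apply, Matrix.cons_val]
  ring

theorem bezoutDet_add_smul_left (r a0 a1 a2 a3 b0 b1 b2 b3 : ℝ) :
    bezoutDet (a0 + r * b0) (a1 + r * b1) (a2 + r * b2) (a3 + r * b3) b0 b1 b2 b3
      = bezoutDet a0 a1 a2 a3 b0 b1 b2 b3 := by
  simp only [bezoutDet, Matrix.det_fin_three, Matrix.of_apply, Matrix.cons_val]
  ring

theorem bezoutDet_zero_left (b0 b1 b2 b3 : ℝ) : bezoutDet 0 0 0 0 b0 b1 b2 b3 = 0 := by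
  simp [bezoutDet, Matrix.det_fin_three]

theorem bezoutDet_zero_right (a0 a1 a2 a3 : ℝ) : bezoutDet a0 a1 a2 a3 0 0 0 0 = 0 := by
  simp [bezoutDet, Matrix.det_fin_three]

theorem bezoutDet_eq_zero_of_common_root {a0 a1 a2 a3 b0 b1 b2 b3 x : ℝ}
    (ha : a3 * (-x) ^ 3 + a2 * (-x) ^ 2 + a1 * (-x) + a0 = 0)
    (hb : b3 * (-x) ^ 3 + b2 * (-x) ^ 2 + b1 * (-x) + b0 = 0) :
    bezoutDet a0 a1 a2 a3 b0 b1 b2 b3 = 0 := by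
  obtain rfl : a0 = a3 * x ^ 3 - a2 * x ^ 2 + a1 * x := by linarith
  obtain rfl : b0 = b3 * x ^ 3 - b2 * x ^ 2 + b1 * x := by linarith
  simp only [bezoutDet, Matrix.det_fin_three, Matrix.of_apply, Matrix.cons_val]
  ring

theorem bezoutDet_linear_mul (c0 c1 c2 d0 d1 d2 x r : ℝ) :
    bezoutDet (x * c0) (c0 + x * c1) (c1 + x * c2) c2
        (x * d0 + r * c0) (d0 + x * d1 + r * c1) (d1 + x * d2 + r * c2) d2
      = r * (c2 * x ^ 2 - c1 * x + c0) ^ 2 *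
        ((c2 * d0 - c0 * d2) ^ 2 - (c1 * d0 - c0 * d1) * (c2 * d1 - c1 * d2)) := by
  simp only [bezoutDet, Matrix.det_fin_three, Matrix.of_apply, Matrix.cons_val]
  ring

theorem coeff_signs_of_nonneg {c0 c1 c2 d0 d1 d2 : ℝ}
    (hc0 : 0 ≤ c0) (hc1 : 0 ≤ c1) (hc2 : 0 ≤ c2) (hd0 : 0 ≤ d0) (hd1 : 0 ≤ d1)
    (hl : 0 ≤ c0 * (c2 * d0 - c0 * d2) - c1 * (c1 * d0 - c0 * d1))
    (h2 : c2 * d0 - c0 * d2 ≤ 0)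
    (hK : 0 < (c2 * d0 - c0 * d2) ^ 2 - (c1 * d0 - c0 * d1) * (c2 * d1 - c1 * d2)) :
    c0 ≠ 0 ∧ c2 ≠ 0 ∧ c1 * d0 - c0 * d1 < 0 := by
  have key : c0 * ((c2 * d0 - c0 * d2) ^ 2 - (c1 * d0 - c0 * d1) * (c2 * d1 - c1 * d2))
      = (c2 * d0 - c0 * d2) * (c0 * (c2 * d0 - c0 * d2) - c1 * (c1 * d0 - c0 * d1))
        + c2 * (c1 * d0 - c0 * d1) ^ 2 := by ring
  have hneg := mul_nonpos_of_nonpos_of_nonneg h2 hl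
  have h0 : c0 ≠ 0 := by
    rintro rfl
    have e1 : c1 ^ 2 * d0 = 0 := le_antisymm (by linarith) (by positivity)
    have e2 : c2 * d0 = 0 := le_antisymm (by linarith) (by positivity)
    have e3 : c1 * d0 = 0 := by
      rcases mul_eq_zero.1 e1 with h | h
      · rw [pow_eq_zero_iff two_ne_zero |>.1 h, zero_mul]
      · rw [h, mul_zero]
    simp [e2, e3] at hK
  have h0' : 0 < c0 := lt_of_le_of_ne hc0 h0.symm
  have hpos := mul_pos h0' hK
  have hca : 0 < c2 * (c1 * d0 - c0 * d1) ^ 2 := by linarith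
  refine ⟨h0, ?_, ?_⟩
  · rintro rfl
    simp at hca
  · by_contra! hα
    have e1 := mul_nonpos_of_nonneg_of_nonpos hc0 h2
    have e2 := mul_nonneg hc1 hα
    have e3 : c1 * (c1 * d0 - c0 * d1) = 0 := by linarith
    rcases mul_eq_zero.1 e3 with h | h
    · rw [h] at hα hca
      have : c0 * d1 = 0 := le_antisymm (by linarith) (by positivity)
      simp [this] at hca
    · simp [h] at hca

theorem coeff_signs_of_pos {c0 c1 c2 d0 d1 d2 : ℝ} (hc0 : 0 < c0)
    (hc2 : c2 ≠ 0) (hd0 : 0 ≤ c0 * d0)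
    (hl : 0 ≤ c2 * (c0 * (c2 * d0 - c0 * d2) - c1 * (c1 * d0 - c0 * d1)))
    (h2 : 0 ≤ -((c2 * d0 - c0 * d2) * c0 * c2))
    (h1 : c1 * d0 - c0 * d1 < 0)
    (hK : 0 < (c2 * d0 - c0 * d2) ^ 2 - (c1 * d0 - c0 * d1) * (c2 * d1 - c1 * d2)) :
    0 ≤ c1 ∧ 0 ≤ c2 ∧ 0 ≤ d0 ∧ 0 ≤ d1 ∧ 0 ≤ d2 ∧
      0 ≤ c0 * (c2 * d0 - c0 * d2) - c1 * (c1 * d0 - c0 * d1) ∧ c2 * d0 - c0 * d2 ≤ 0 := by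
  have key : c2 ^ 2 * c0 ^ 2 *
        ((c2 * d0 - c0 * d2) ^ 2 - (c1 * d0 - c0 * d1) * (c2 * d1 - c1 * d2))
      = ((c2 * d0 - c0 * d2) * c0 * c2) *
          (c2 * (c0 * (c2 * d0 - c0 * d2) - c1 * (c1 * d0 - c0 * d1)))
        + c2 * (c2 ^ 2 * c0 * (c1 * d0 - c0 * d1) ^ 2) := by ring
  have hneg := mul_nonneg h2 hl
  have hpos : 0 < c2 ^ 2 * c0 ^ 2 *
        ((c2 * d0 - c0 * d2) ^ 2 - (c1 * d0 - c0 * d1) * (c2 * d1 - c1 * d2)) := by positivity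
  have hc2' : 0 < c2 := by
    refine pos_of_mul_pos_left (b := c2 ^ 2 * c0 * (c1 * d0 - c0 * d1) ^ 2) ?_ (by positivity)
    linarith
  have hd0' : 0 ≤ d0 := nonneg_of_mul_nonneg_right hd0 hc0
  have hl' := nonneg_of_mul_nonneg_right hl hc2'
  have h2' : c2 * d0 - c0 * d2 ≤ 0 := by
    have : 0 ≤ (c0 * c2) * -(c2 * d0 - c0 * d2) := by linarith
    linarith [nonneg_of_mul_nonneg_right this (by positivity)]
  have hc1 : 0 ≤ c1 := by
    have e := mul_nonpos_of_nonneg_of_nonpos hc0.le h2'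
    have : 0 ≤ -(c1 * d0 - c0 * d1) * c1 := by linarith
    exact nonneg_of_mul_nonneg_right this (by linarith)
  have hd1 : 0 ≤ d1 := by
    have : 0 ≤ c0 * d1 := by linarith [mul_nonneg hc1 hd0']
    exact nonneg_of_mul_nonneg_right this hc0
  have hd2 : 0 ≤ d2 := by
    have : 0 ≤ c0 * d2 := by linarith [mul_nonneg hc2'.le hd0']
    exact nonneg_of_mul_nonneg_right this hc0
  exact ⟨hc1, hc2'.le, hd0', hd1, hd2, hl', h2'⟩

/-- A quadratic with nonnegative coefficients vanishes if its product with `-(s + x)`, `x ≥ 0`,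
has nonnegative coefficients of degree one and more. -/
theorem quadratic_eq_zero {q0 q1 q2 x : ℝ} (hx : 0 ≤ x)
    (h0 : 0 ≤ q0) (h1 : 0 ≤ q1) (h2 : 0 ≤ q2)
    (e3 : q2 ≤ 0) (e2 : q1 + x * q2 ≤ 0) (e1 : q0 + x * q1 ≤ 0) :
    q0 = 0 ∧ q1 = 0 ∧ q2 = 0 := by
  have := mul_nonneg hx h1
  have := mul_nonneg hx h2
  refine ⟨?_, ?_, ?_⟩ <;> linarith

theorem ne_zero_of_coeffs_nonneg {a0 a1 a2 a3 b0 b1 b2 b3 x p q r c0 c1 c2 d0 d1 d2 : ℝ}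
    (hx : 0 ≤ x)
    (hb1 : 0 ≤ b1) (hb2 : 0 ≤ b2) (hb3 : 0 ≤ b3)
    (hp : 0 ≤ p) (hc0 : 0 ≤ c0) (hc1 : 0 ≤ c1) (hc2 : 0 ≤ c2)
    (hd0 : 0 ≤ d0) (hd1 : 0 ≤ d1) (hd2 : 0 ≤ d2)
    (ec0 : x * c0 = q * a0 + -p * b0) (ec1 : c0 + x * c1 = q * a1 + -p * b1)
    (ec2 : c1 + x * c2 = q * a2 + -p * b2) (ec3 : c2 = q * a3 + -p * b3)
    (ed0 : x * d0 + q ^ 2 * c0 = q * r * b0) (ed1 : d0 + x * d1 + q ^ 2 * c1 = q * r * b1)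
    (ed2 : d1 + x * d2 + q ^ 2 * c2 = q * r * b2)
    (hpq : p ≠ 0 ∨ q ≠ 0) (hR : bezoutDet a0 a1 a2 a3 b0 b1 b2 b3 ≠ 0) :
    q ≠ 0 ∧ r ≠ 0 := by
  have hq : q ≠ 0 := by
    rintro rfl
    have hp' : p ≠ 0 := by simpa using hpq
    obtain ⟨rfl, rfl, rfl⟩ := quadratic_eq_zero hx hc0 hc1 hc2
      (by linarith [mul_nonneg hp hb3]) (by linarith [mul_nonneg hp hb2])
      (by linarith [mul_nonneg hp hb1])
    simp [hp'] at ec0 ec1 ec2 ec3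
    rw [ec0, ec1, ec2, ec3] at hR
    exact hR (bezoutDet_zero_right a0 a1 a2 a3)
  refine ⟨hq, ?_⟩
  rintro rfl
  have hq2 : 0 < q ^ 2 := by positivity
  have hxd0 := mul_nonneg hx hd0
  have hxd1 := mul_nonneg hx hd1
  have hxd2 := mul_nonneg hx hd2
  have vanish {t : ℝ} (ht : 0 ≤ t) (h : q ^ 2 * t ≤ 0) : t = 0 :=
    le_antisymm (nonpos_of_mul_nonpos_right h hq2) ht
  have z0 : c0 = 0 := vanish hc0 (by linarith)
  have z1 : c1 = 0 := vanish hc1 (by linarith)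
  have z2 : c2 = 0 := vanish hc2 (by linarith)
  have h := bezoutDet_add_smul_left (-p) (q * a0) (q * a1) (q * a2) (q * a3) b0 b1 b2 b3
  rw [← ec0, ← ec1, ← ec2, ← ec3, bezoutDet_smul_left, z0, z1, z2] at h
  simp [bezoutDet_zero_left, hq, hR] at h

theorem coeffs_nonneg {a0 a1 a2 a3 b0 b1 b2 b3 x p q r c0 c1 c2 d0 d1 d2 : ℝ}
    (hx : 0 ≤ x) (hbpos : 0 < b0 ∨ 0 < b1 ∨ 0 < b2 ∨ 0 < b3)
    (hpq : 0 ≤ q * p) (hq : q ≠ 0) (hr : 0 < r)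
    (hc0 : 0 ≤ c0) (hc1 : 0 ≤ c1) (hc2 : 0 ≤ c2)
    (hd0 : 0 ≤ d0) (hd1 : 0 ≤ d1) (hd2 : 0 ≤ d2)
    (ec0 : x * c0 = q * a0 + -p * b0) (ec1 : c0 + x * c1 = q * a1 + -p * b1)
    (ec2 : c1 + x * c2 = q * a2 + -p * b2) (ec3 : c2 = q * a3 + -p * b3)
    (ed0 : x * d0 + q ^ 2 * c0 = q * r * b0) (ed1 : d0 + x * d1 + q ^ 2 * c1 = q * r * b1)
    (ed2 : d1 + x * d2 + q ^ 2 * c2 = q * r * b2) (ed3 : d2 = q * r * b3) :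
    0 ≤ p ∧ 0 ≤ q ∧
      0 ≤ a0 ∧ 0 ≤ a1 ∧ 0 ≤ a2 ∧ 0 ≤ a3 ∧ 0 ≤ b0 ∧ 0 ≤ b1 ∧ 0 ≤ b2 ∧ 0 ≤ b3 := by
  have n0 : 0 ≤ q * r * b0 := ed0 ▸ by positivity
  have n1 : 0 ≤ q * r * b1 := ed1 ▸ by positivity
  have n2 : 0 ≤ q * r * b2 := ed2 ▸ by positivity
  have n3 : 0 ≤ q * r * b3 := ed3 ▸ hd2
  have hqr : 0 ≤ q * r := by
    rcases hbpos with h | h | h | h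
    · exact nonneg_of_mul_nonneg_left n0 h
    · exact nonneg_of_mul_nonneg_left n1 h
    · exact nonneg_of_mul_nonneg_left n2 h
    · exact nonneg_of_mul_nonneg_left n3 h
  have hq' : 0 < q := lt_of_le_of_ne (nonneg_of_mul_nonneg_left hqr hr) hq.symm
  have hqr' : 0 < q * r := mul_pos hq' hr
  have hp : 0 ≤ p := nonneg_of_mul_nonneg_right hpq hq'
  have hb0 := nonneg_of_mul_nonneg_right n0 hqr'
  have hb1 := nonneg_of_mul_nonneg_right n1 hqr'
  have hb2 := nonneg_of_mul_nonneg_right n2 hqr'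
  have hb3 := nonneg_of_mul_nonneg_right n3 hqr'
  have m0 : q * a0 = x * c0 + p * b0 := by linarith
  have m1 : q * a1 = c0 + x * c1 + p * b1 := by linarith
  have m2 : q * a2 = c1 + x * c2 + p * b2 := by linarith
  have m3 : q * a3 = c2 + p * b3 := by linarith
  refine ⟨hp, hq'.le, ?_, ?_, ?_, ?_, hb0, hb1, hb2, hb3⟩ <;>
    refine nonneg_of_mul_nonneg_right ?_ hq'
  · rw [m0]; positivity
  · rw [m1]; positivity
  · rw [m2]; positivity
  · rw [m3]; positivity

/-- with `x ≥ 0`, condition (C3) holds iff condition (CA3) holds. -/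
theorem stmt_10 (a0 a1 a2 a3 b0 b1 b2 b3 x : ℝ) (hx : 0 ≤ x)
    (a b : ℝ → ℝ)
    (ha : ∀ s, a s = a3 * s ^ 3 + a2 * s ^ 2 + a1 * s + a0)
    (hb : ∀ s, b s = b3 * s ^ 3 + b2 * s ^ 2 + b1 * s + b0)
    (atil btil : ℝ) (hatil : atil = a (-x)) (hbtil : btil = b (-x))
    (c0 c1 c2 : ℝ)
    (hc : ∀ s, (c2 * s ^ 2 + c1 * s + c0) * (s + x) = a s * b (-x) - b s * a (-x))
    (ctil : ℝ) (hctil : ctil = c2 * x ^ 2 - c1 * x + c0)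
    (d0 d1 d2 : ℝ)
    (hd : ∀ s, (d2 * s ^ 2 + d1 * s + d0) * (s + x)
        = b (-x) * (b s * ctil - b (-x) * (c2 * s ^ 2 + c1 * s + c0)))
    (alpha1 alpha2 alpha3 : ℝ)
    (halpha1 : alpha1 = c1 * d0 - c0 * d1)
    (halpha2 : alpha2 = c2 * d0 - c0 * d2)
    (halpha3 : alpha3 = c2 * d1 - c1 * d2)
    (lambda4 : ℝ) (hlambda4 : lambda4 = c0 * alpha2 - c1 * alpha1)
    (B : Matrix (Fin 3) (Fin 3) ℝ) (hBsymm : B.IsSymm)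
    (hB : ∀ z w : ℝ, z ≠ w →
        b z * a w - a z * b w
          = (z - w) * ∑ i : Fin 3, ∑ j : Fin 3, B i j * z ^ (i : ℕ) * w ^ (j : ℕ))
    (R0ab : ℝ) (hR0 : R0ab = B.det)
    :
    -- (C3)
    (((0 ≤ a0 ∧ 0 ≤ a1 ∧ 0 ≤ a2 ∧ 0 ≤ a3 ∧ 0 ≤ b0 ∧ 0 ≤ b1 ∧ 0 ≤ b2 ∧ 0 ≤ b3) ∧
      SameSign [atil, btil, c0, c1, c2, d0, d1, d2, lambda4] ∧
      0 ≤ ctil ∧ 0 ≤ -alpha2 ∧ 0 < R0ab)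
    ↔
    -- (CA3)
    ((0 < b0 ∨ 0 < b1 ∨ 0 < b2 ∨ 0 < b3) ∧
      SameSign [atil, btil] ∧ btil ≠ 0 ∧
      0 ≤ c0 * d0 ∧ 0 ≤ c2 * lambda4 ∧ 0 ≤ -(alpha2 * c0 * c2) ∧
      c0 ≠ 0 ∧ c2 ≠ 0 ∧ 0 < ctil ∧ alpha1 < 0 ∧ 0 < R0ab)) := by
  obtain rfl : a = fun s => a3 * s ^ 3 + a2 * s ^ 2 + a1 * s + a0 := funext ha
  obtain rfl : b = fun s => b3 * s ^ 3 + b2 * s ^ 2 + b1 * s + b0 := funext hb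
  rw [det_eq_bezoutDet hBsymm hB] at hR0
  simp only [← hatil, ← hbtil] at hc hd
  obtain ⟨ec0, ec1, ec2, ec3⟩ := cubic_coeff_eq
    (p0 := x * c0) (p1 := c0 + x * c1) (p2 := c1 + x * c2) (p3 := c2)
    (q0 := btil * a0 + -atil * b0) (q1 := btil * a1 + -atil * b1)
    (q2 := btil * a2 + -atil * b2) (q3 := btil * a3 + -atil * b3)
    (fun s => by linear_combination hc s)
  obtain ⟨ed0, ed1, ed2, ed3⟩ := cubic_coeff_eq
    (p0 := x * d0 + btil ^ 2 * c0) (p1 := d0 + x * d1 + btil ^ 2 * c1)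
    (p2 := d1 + x * d2 + btil ^ 2 * c2) (p3 := d2)
    (q0 := btil * ctil * b0) (q1 := btil * ctil * b1)
    (q2 := btil * ctil * b2) (q3 := btil * ctil * b3)
    (fun s => by linear_combination hd s)
  have hres : bezoutDet (x * c0) (c0 + x * c1) (c1 + x * c2) c2 b0 b1 b2 b3
      = btil ^ 3 * R0ab := by
    rw [ec0, ec1, ec2, ec3, bezoutDet_add_smul_left, bezoutDet_smul_left, hR0]
  have hK : 0 < R0ab → btil ≠ 0 → 0 < ctil → 0 < alpha2 ^ 2 - alpha1 * alpha3 := by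
    intro hR hb0 hct
    have h := bezoutDet_linear_mul c0 c1 c2 d0 d1 d2 x (btil ^ 2)
    rw [← hctil, ← halpha1, ← halpha2, ← halpha3, ed0, ed1, ed2, ed3, bezoutDet_smul_right,
      hres] at h
    have h' : (btil ^ 2 * ctil ^ 2) * (alpha2 ^ 2 - alpha1 * alpha3)
        = (btil ^ 2 * ctil ^ 2) * (btil ^ 4 * ctil * R0ab) := by linear_combination -h
    rw [mul_left_cancel₀ (by positivity) h']
    positivity
  have hroot : 0 < R0ab → atil ≠ 0 ∨ btil ≠ 0 := by
    intro hR
    by_contra! h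
    rw [hR0, bezoutDet_eq_zero_of_common_root (hatil.symm.trans h.1) (hbtil.symm.trans h.2)] at hR
    exact hR.false
  simp only [SameSign, List.forall_mem_cons, List.not_mem_nil, false_imp_iff, implies_true,
    and_true]
  rw [hlambda4]
  constructor
  · rintro ⟨⟨ha0, ha1, ha2, ha3, hb0, hb1, hb2, hb3⟩, hS, hct, hα2, hR⟩
    have hne : btil ≠ 0 ∧ ctil ≠ 0 := by
      rcases hS with ⟨h1, -, h3, h4, h5, h6, h7, h8, -⟩ | ⟨h1, -, h3, h4, h5, h6, h7, h8, -⟩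
      · exact ne_zero_of_coeffs_nonneg hx hb1 hb2 hb3 h1 h3 h4 h5 h6 h7 h8
          ec0 ec1 ec2 ec3 ed0 ed1 ed2 (hroot hR) (hR0 ▸ hR.ne')
      · have := ne_zero_of_coeffs_nonneg (a0 := a0) (a1 := a1) (a2 := a2) (a3 := a3)
          (p := -atil) (q := -btil) (r := ctil)
          (c0 := -c0) (c1 := -c1) (c2 := -c2) (d0 := -d0) (d1 := -d1) (d2 := -d2)
          hx hb1 hb2 hb3 (by linarith) (by linarith) (by linarith) (by linarith)
          (by linarith) (by linarith) (by linarith)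
          (by linarith) (by linarith) (by linarith) (by linarith)
          (by linarith) (by linarith) (by linarith) (by simpa using hroot hR) (hR0 ▸ hR.ne')
        simpa using this
    have hct' : 0 < ctil := lt_of_le_of_ne hct hne.2.symm
    have hK' := hK hR hne.1 hct'
    subst halpha1 halpha2 halpha3
    have hsigns : c0 ≠ 0 ∧ c2 ≠ 0 ∧ c1 * d0 - c0 * d1 < 0 := by
      rcases hS with ⟨-, -, h3, h4, h5, h6, h7, -, h9⟩ | ⟨-, -, h3, h4, h5, h6, h7, -, h9⟩
      · exact coeff_signs_of_nonneg h3 h4 h5 h6 h7 h9 (by linarith) hK'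
      · have := coeff_signs_of_nonneg (c0 := -c0) (c1 := -c1) (c2 := -c2)
          (d0 := -d0) (d1 := -d1) (d2 := -d2) (by linarith) (by linarith) (by linarith)
          (by linarith) (by linarith) (by linarith) (by linarith) (by linarith)
        simpa using this
    have hb : 0 < b0 ∨ 0 < b1 ∨ 0 < b2 ∨ 0 < b3 := by
      by_contra! h
      obtain rfl : b0 = 0 := by linarith
      obtain rfl : b1 = 0 := by linarith
      obtain rfl : b2 = 0 := by linarith
      obtain rfl : b3 = 0 := by linarith
      rw [hR0, bezoutDet_zero_right] at hR
      exact hR.false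
    rcases hS with ⟨h1, h2, h3, -, h5, h6, -, -, h9⟩ | ⟨h1, h2, h3, -, h5, h6, -, -, h9⟩
    · refine ⟨hb, Or.inl ⟨h1, h2⟩, hne.1, mul_nonneg h3 h6, mul_nonneg h5 h9, ?_,
        hsigns.1, hsigns.2.1, hct', hsigns.2.2, hR⟩
      linarith [mul_nonneg hα2 (mul_nonneg h3 h5)]
    · refine ⟨hb, Or.inr ⟨h1, h2⟩, hne.1, mul_nonneg_of_nonpos_of_nonpos h3 h6,
        mul_nonneg_of_nonpos_of_nonpos h5 h9, ?_, hsigns.1, hsigns.2.1, hct', hsigns.2.2, hR⟩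
      linarith [mul_nonneg hα2 (mul_nonneg_of_nonpos_of_nonpos h3 h5)]
  · rintro ⟨hbpos, hS, hbt, hcd, hcl, hαc, hc0, hc2, hct, hα1, hR⟩
    have hK' := hK hR hbt hct
    have hpq : 0 ≤ btil * atil := by
      rcases hS with h | h
      · exact mul_nonneg h.2 h.1
      · exact mul_nonneg_of_nonpos_of_nonpos h.2 h.1
    subst halpha1 halpha2 halpha3
    rcases hc0.lt_or_gt with h0 | h0
    · obtain ⟨h1, h2, k0, k1, k2, hl, hα⟩ := coeff_signs_of_pos
        (c0 := -c0) (c1 := -c1) (c2 := -c2) (d0 := -d0) (d1 := -d1) (d2 := -d2)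
        (by linarith) (by simpa using hc2) (by linarith) (by linarith) (by linarith)
        (by linarith) (by linarith)
      obtain ⟨hp, hq, hab⟩ := coeffs_nonneg (a0 := a0) (a1 := a1) (a2 := a2) (a3 := a3)
        (p := -atil) (q := -btil) (r := ctil) (c0 := -c0) hx hbpos
        (by linarith) (by simpa using hbt) hct (by linarith) h1 h2 k0 k1 k2
        (by linarith) (by linarith) (by linarith) (by linarith)
        (by linarith) (by linarith) (by linarith) (by linarith)
      refine ⟨hab, Or.inr ⟨?_, ?_, ?_, ?_, ?_, ?_, ?_, ?_, ?_⟩, hct.le, ?_, hR⟩ <;> linarith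
    · obtain ⟨h1, h2, k0, k1, k2, hl, hα⟩ := coeff_signs_of_pos h0 hc2 hcd hcl hαc hα1 hK'
      obtain ⟨hp, hq, hab⟩ := coeffs_nonneg hx hbpos hpq hbt hct h0.le h1 h2 k0 k1 k2
        ec0 ec1 ec2 ec3 ed0 ed1 ed2 ed3
      exact ⟨hab, Or.inl ⟨hp, hq, h0.le, h1, h2, k0, k1, k2, hl⟩, hct.le, by linarith, hR⟩
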